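/- (Projection lemma) For all propositional statements P, Q, R, all n ∈ ℕ with n ≥ 1, and all k, ℓ, m ∈ ℕ, the identity π_n(P◁Q▷R) = π_n(π_{n+k}(P) ◁ π_{n+ℓ}(Q) ▷ π_{n+m}(R)) is derivable in CP + PR. In particular, π_n(P◁Q▷R) = π_n(π_n(P) ◁ π_n(Q) ▷ π_n(R)). -/

import Mathlib

/-- Propositional statements over atoms `A`: constants `T`, `F`, an atom `a`
for each `a ∈ A`, and the ternary conditional composition
`cond x y z = x ◁ y ▷ z` (with `y` the central condition). -/
inductive PS (A : Type) : Type where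
  | tt : PS A
  | ff : PS A
  | atom : A → PS A
  | cond : PS A → PS A → PS A → PS A

/-- Terms of the signature of `CP + PR`: propositional statements extended
with the unary projection operators `π_n` (`n ∈ ℕ`, meaningful for `n ≥ 1`). -/
inductive PT (A : Type) : Type where
  | tt : PT A
  | ff : PT A
  | atom : A → PT A
  | cond : PT A → PT A → PT A → PT A
  | proj : ℕ → PT A → PT A

/-- The embedding of propositional statements into the extended signature. -/
def PS.toPT {A : Type} : PS A → PT A
  | .tt => .tt
  | .ff => .ff
  | .atom a => .atom a
  | .cond p q r => .cond p.toPT q.toPT r.toPT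

/-- Derivability (of closed equations) in the equational theory `CP + PR`:
the axioms `(CP1)`–`(CP4)` of `CP` together with the defining equations `PR`
of the projection operators `π_n` (`n ≥ 1`). -/
inductive PRDeriv {A : Type} : PT A → PT A → Prop where
  | cp1 (x y) : PRDeriv (.cond x .tt y) x
  | cp2 (x y) : PRDeriv (.cond x .ff y) y
  | cp3 (x) : PRDeriv (.cond .tt x .ff) x
  | cp4 (x y z u v) :
      PRDeriv (.cond x (.cond y z u) v)
              (.cond (.cond x y v) z (.cond x u v))
  | pr_tt {n : ℕ} (hn : 1 ≤ n) : PRDeriv (.proj n .tt) .tt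
  | pr_ff {n : ℕ} (hn : 1 ≤ n) : PRDeriv (.proj n .ff) .ff
  | pr_one (a : A) (x y) : PRDeriv (.proj 1 (.cond x (.atom a) y)) (.atom a)
  | pr_succ {n : ℕ} (hn : 1 ≤ n) (a : A) (x y) :
      PRDeriv (.proj (n + 1) (.cond x (.atom a) y))
              (.cond (.proj n x) (.atom a) (.proj n y))
  | refl (x) : PRDeriv x x
  | symm {p q} : PRDeriv p q → PRDeriv q p
  | trans {p q r} : PRDeriv p q → PRDeriv q r → PRDeriv p r
  | congr_cond {x x' y y' z z'} :
      PRDeriv x x' → PRDeriv y y' → PRDeriv z z' →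
      PRDeriv (.cond x y z) (.cond x' y' z')
  | congr_proj (n : ℕ) {p q} : PRDeriv p q → PRDeriv (.proj n p) (.proj n q)

namespace PRDeriv

variable {A : Type}

instance : Trans (PRDeriv (A := A)) PRDeriv PRDeriv := ⟨trans⟩

/-- Basic forms: closed terms built from `T` and `F` by post-conditional composition
over atoms. -/
inductive IsBasic : PT A → Prop where
  | tt : IsBasic .tt
  | ff : IsBasic .ff
  | cond (a : A) {x y : PT A} : IsBasic x → IsBasic y → IsBasic (.cond x (.atom a) y)

theorem IsBasic.exists_cond {p q r : PT A} (hq : IsBasic q) (hp : IsBasic p) (hr : IsBasic r) :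
    ∃ b, IsBasic b ∧ PRDeriv (.cond p q r) b := by
  induction hq with
  | tt => exact ⟨p, hp, cp1 _ _⟩
  | ff => exact ⟨r, hr, cp2 _ _⟩
  | cond a _ _ ihx ihy =>
    obtain ⟨b, hb, hxb⟩ := ihx
    obtain ⟨c, hc, hyc⟩ := ihy
    exact ⟨_, .cond a hb hc, (cp4 _ _ _ _ _).trans (congr_cond hxb (refl _) hyc)⟩

/-- Every propositional statement is derivably equal to a basic form. -/
theorem exists_isBasic (P : PS A) : ∃ b, IsBasic b ∧ PRDeriv P.toPT b := by
  induction P with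
  | tt => exact ⟨_, .tt, refl _⟩
  | ff => exact ⟨_, .ff, refl _⟩
  | atom a => exact ⟨_, .cond a .tt .ff, (cp3 _).symm⟩
  | cond P Q R ihP ihQ ihR =>
    obtain ⟨p, hp, hPp⟩ := ihP
    obtain ⟨q, hq, hQq⟩ := ihQ
    obtain ⟨r, hr, hRr⟩ := ihR
    obtain ⟨b, hb, hpqr⟩ := hq.exists_cond hp hr
    exact ⟨b, hb, (congr_cond hPp hQq hRr).trans hpqr⟩

/-- A projection preserves the root atom of a term. -/
theorem exists_proj_cond_atom {n : ℕ} (hn : 1 ≤ n) (a : A) (x y : PT A) :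
    ∃ x' y', PRDeriv (.proj n (.cond x (.atom a) y)) (.cond x' (.atom a) y') := by
  obtain rfl | ⟨n, hn', rfl⟩ : n = 1 ∨ ∃ m, 1 ≤ m ∧ n = m + 1 := by
    rcases n with _ | _ | n
    · omega
    · exact .inl rfl
    · exact .inr ⟨n + 1, by omega, rfl⟩
  · exact ⟨_, _, (pr_one _ _ _).trans (cp3 _).symm⟩
  · exact ⟨_, _, pr_succ hn' _ _ _⟩

theorem IsBasic.proj_proj {p : PT A} (hp : IsBasic p) {n i : ℕ} (hn : 1 ≤ n) (hi : n ≤ i) :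
    PRDeriv (.proj n (.proj i p)) (.proj n p) := by
  induction hp generalizing n i with
  | tt => exact congr_proj n (pr_tt (hn.trans hi))
  | ff => exact congr_proj n (pr_ff (hn.trans hi))
  | @cond a x y _ _ ihx ihy =>
    induction n, hn using Nat.le_induction with
    | base =>
      obtain ⟨x', y', h⟩ := exists_proj_cond_atom hi a x y
      exact (congr_proj 1 h).trans ((pr_one _ _ _).trans (pr_one _ _ _).symm)
    | succ n hn _ =>
      obtain ⟨i, rfl⟩ := Nat.exists_eq_add_of_le' (Nat.le_of_add_left_le hi)
      have hi' : n ≤ i := Nat.le_of_succ_le_succ hi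
      calc
        PRDeriv _ (.proj (n + 1) (.cond (.proj i x) (.atom a) (.proj i y))) :=
          congr_proj _ (pr_succ (hn.trans hi') _ _ _)
        PRDeriv _ (.cond (.proj n (.proj i x)) (.atom a) (.proj n (.proj i y))) :=
          pr_succ hn _ _ _
        PRDeriv _ (.cond (.proj n x) (.atom a) (.proj n y)) :=
          congr_cond (ihx hn hi') (refl _) (ihy hn hi')
        PRDeriv _ _ := (pr_succ hn _ _ _).symm

theorem IsBasic.proj_cond {p q r : PT A} (hq : IsBasic q) (hp : IsBasic p) (hr : IsBasic r)
    {n i j k : ℕ} (hn : 1 ≤ n) (hi : n ≤ i) (hj : n ≤ j) (hk : n ≤ k) :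
    PRDeriv (.proj n (.cond p q r))
      (.proj n (.cond (.proj i p) (.proj j q) (.proj k r))) := by
  induction hq generalizing n j with
  | tt =>
    calc
      PRDeriv _ (.proj n p) := congr_proj n (cp1 _ _)
      PRDeriv _ (.proj n (.proj i p)) := (hp.proj_proj hn hi).symm
      PRDeriv _ (.proj n (.cond (.proj i p) .tt (.proj k r))) := congr_proj n (cp1 _ _).symm
      PRDeriv _ _ := congr_proj n (congr_cond (refl _) (pr_tt (hn.trans hj)).symm (refl _))
  | ff =>
    calc
      PRDeriv _ (.proj n r) := congr_proj n (cp2 _ _)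
      PRDeriv _ (.proj n (.proj k r)) := (hr.proj_proj hn hk).symm
      PRDeriv _ (.proj n (.cond (.proj i p) .ff (.proj k r))) := congr_proj n (cp2 _ _).symm
      PRDeriv _ _ := congr_proj n (congr_cond (refl _) (pr_ff (hn.trans hj)).symm (refl _))
  | @cond a x y _ _ ihx ihy =>
    induction n, hn using Nat.le_induction with
    | base =>
      obtain ⟨x', y', h⟩ := exists_proj_cond_atom hj a x y
      calc
        PRDeriv _ (.proj 1 (.cond (.cond p x r) (.atom a) (.cond p y r))) :=
          congr_proj 1 (cp4 _ _ _ _ _)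
        PRDeriv _ (.atom a) := pr_one _ _ _
        PRDeriv _ (.proj 1 (.cond (.cond (.proj i p) x' (.proj k r)) (.atom a)
            (.cond (.proj i p) y' (.proj k r)))) := (pr_one _ _ _).symm
        PRDeriv _ (.proj 1 (.cond (.proj i p) (.cond x' (.atom a) y') (.proj k r))) :=
          congr_proj 1 (cp4 _ _ _ _ _).symm
        PRDeriv _ _ := congr_proj 1 (congr_cond (refl _) h.symm (refl _))
    | succ n hn _ =>
      obtain ⟨j, rfl⟩ := Nat.exists_eq_add_of_le' (Nat.le_of_add_left_le hj)
      have hj' : n ≤ j := Nat.le_of_succ_le_succ hj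
      have hi' : n ≤ i := Nat.le_of_succ_le hi
      have hk' : n ≤ k := Nat.le_of_succ_le hk
      calc
        PRDeriv _ (.proj (n + 1) (.cond (.cond p x r) (.atom a) (.cond p y r))) :=
          congr_proj _ (cp4 _ _ _ _ _)
        PRDeriv _ (.cond (.proj n (.cond p x r)) (.atom a) (.proj n (.cond p y r))) :=
          pr_succ hn _ _ _
        PRDeriv _ (.cond (.proj n (.cond (.proj i p) (.proj j x) (.proj k r))) (.atom a)
            (.proj n (.cond (.proj i p) (.proj j y) (.proj k r)))) :=
          congr_cond (ihx hn hi' hj' hk') (refl _) (ihy hn hi' hj' hk')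
        PRDeriv _ (.proj (n + 1) (.cond (.cond (.proj i p) (.proj j x) (.proj k r)) (.atom a)
            (.cond (.proj i p) (.proj j y) (.proj k r)))) := (pr_succ hn _ _ _).symm
        PRDeriv _ (.proj (n + 1) (.cond (.proj i p)
            (.cond (.proj j x) (.atom a) (.proj j y)) (.proj k r))) :=
          congr_proj _ (cp4 _ _ _ _ _).symm
        PRDeriv _ _ :=
          congr_proj _ (congr_cond (refl _) (pr_succ (hn.trans hj') _ _ _).symm (refl _))

theorem proj_cond_toPT (P Q R : PS A) {n i j k : ℕ} (hn : 1 ≤ n) (hi : n ≤ i) (hj : n ≤ j)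
    (hk : n ≤ k) :
    PRDeriv (.proj n (PS.cond P Q R).toPT)
      (.proj n (.cond (.proj i P.toPT) (.proj j Q.toPT) (.proj k R.toPT))) := by
  obtain ⟨p, hp, hPp⟩ := exists_isBasic P
  obtain ⟨q, hq, hQq⟩ := exists_isBasic Q
  obtain ⟨r, hr, hRr⟩ := exists_isBasic R
  calc
    PRDeriv _ (.proj n (.cond p q r)) := congr_proj n (congr_cond hPp hQq hRr)
    PRDeriv _ (.proj n (.cond (.proj i p) (.proj j q) (.proj k r))) :=
      hq.proj_cond hp hr hn hi hj hk
    PRDeriv _ _ := congr_proj n (congr_cond (congr_proj i hPp.symm) (congr_proj j hQq.symm)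
      (congr_proj k hRr.symm))

end PRDeriv

/-- **Projection lemma**: for all propositional statements `P, Q, R`, all
`n ≥ 1` and all `k, ℓ, m ∈ ℕ`, the identity
`π_n(P◁Q▷R) = π_n(π_{n+k}(P) ◁ π_{n+ℓ}(Q) ▷ π_{n+m}(R))` is derivable in
`CP + PR`; in particular `π_n(P◁Q▷R) = π_n(π_n(P) ◁ π_n(Q) ▷ π_n(R))`. -/
theorem projection_lemma {A : Type} [Countable A] [Nontrivial A]
    (P Q R : PS A) (n : ℕ) (hn : 1 ≤ n) (k l m : ℕ) :
    PRDeriv (.proj n (PS.cond P Q R).toPT)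
      (.proj n (.cond (.proj (n + k) P.toPT) (.proj (n + l) Q.toPT)
        (.proj (n + m) R.toPT))) ∧
    PRDeriv (.proj n (PS.cond P Q R).toPT)
      (.proj n (.cond (.proj n P.toPT) (.proj n Q.toPT)
        (.proj n R.toPT))) := by
  exact ⟨PRDeriv.proj_cond_toPT P Q R hn (by simp) (by simp) (by simp),
    PRDeriv.proj_cond_toPT P Q R hn le_rfl le_rfl le_rfl⟩
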